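/- Let S be an additively reduced, additively Furstenberg semidomain with A₊(S) = S^×, and G a torsion-free abelian group. Every trinomial f = s_0 x^{g_0} + s_1 x^{g_1} + s_2 x^{g_2} ∈ S[G] that is not a sum of three unit monomials can be written as the sum of exactly two irreducible elements of S[G]; if all three coefficients are units, f is itself irreducible. -/

import Mathlib

/-- Witness that `S` is a semidomain: an injective semiring hom into an integral domain. -/
structure SemidomainWitness (S : Type*) [CommSemiring S] where
  D : Type
  [commRing : CommRing D]
  [isDomain : IsDomain D]
  emb : S →+* D
  inj : Function.Injective emb

/-- `S` is a semidomain, i.e. (isomorphic to) a subsemiring of an integral domain. -/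
def IsSemidomain (S : Type*) [CommSemiring S] : Prop := Nonempty (SemidomainWitness S)

/-- `S` is additively reduced: `0` is the only additively invertible element. -/
def AddReduced (S : Type*) [AddZeroClass S] : Prop := ∀ a b : S, a + b = 0 → a = 0

/-- `s` is an atom of the additive monoid `(S, +)` (for `S` additively reduced):
it is nonzero and cannot be written as a sum of two nonzero elements. -/
def IsAddAtom {S : Type*} [AddZeroClass S] (s : S) : Prop :=
  s ≠ 0 ∧ ∀ a b : S, s = a + b → a = 0 ∨ b = 0

/-- `S` is additively Furstenberg: every nonzero element is divisible in `(S, +)`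
by an additive atom. -/
def AddFurstenberg (S : Type*) [AddZeroClass S] : Prop :=
  ∀ s : S, s ≠ 0 → ∃ a t : S, IsAddAtom a ∧ s = a + t


section GroupAlg
variable {S : Type*} [CommSemiring S] {G : Type*} [AddCommGroup G]

/-- A monomial `s·x^g` in the group semidomain `S[G]`. -/
def IsMonomial (f : AddMonoidAlgebra S G) : Prop :=
  ∃ (g : G) (s : S), f = AddMonoidAlgebra.single g s

/-- `f` is monolithic: every factorization of `f` in `S[G]` has a monomial factor. -/
def Monolithic (f : AddMonoidAlgebra S G) : Prop :=
  f ≠ 0 ∧ ∀ p q : AddMonoidAlgebra S G, f = p * q → IsMonomial p ∨ IsMonomial q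

end GroupAlg

open scoped Pointwise

section GroupSemidomain
variable {S : Type*} [CommSemiring S] {G : Type*} [AddCommGroup G]

open AddMonoidAlgebra

theorem IsSemidomain.noZeroDivisors (hS : IsSemidomain S) : NoZeroDivisors S := by
  obtain ⟨D, φ, hφ⟩ := hS
  exact hφ.noZeroDivisors φ (map_zero φ) (map_mul φ)

theorem isMonomial_of_card_support_le_one {p : AddMonoidAlgebra S G}
    (hp : p.coeff.support.card ≤ 1) : IsMonomial p := by
  obtain ⟨g, s, h⟩ := Finsupp.card_support_le_one'.1 hp
  exact ⟨g, s, coeff_injective h⟩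

theorem coeff_mul_add (p q : AddMonoidAlgebra S G) (a b : G) :
    (p * q).coeff (a + b) = p.coeff a * q.coeff b + (p.erase a * q).coeff (a + b) := by
  conv_lhs => rw [← single_add_erase a p, add_mul]
  simp

theorem AddReduced.coeff_mul_ne_zero [NoZeroDivisors S] (hred : AddReduced S)
    {p q : AddMonoidAlgebra S G} {a b : G} (ha : p.coeff a ≠ 0) (hb : q.coeff b ≠ 0) :
    (p * q).coeff (a + b) ≠ 0 := by
  rw [coeff_mul_add]
  exact fun h ↦ mul_ne_zero ha hb (hred _ _ h)

theorem AddReduced.support_coeff_mul [DecidableEq G] [NoZeroDivisors S] (hred : AddReduced S)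
    (p q : AddMonoidAlgebra S G) :
    (p * q).coeff.support = p.coeff.support + q.coeff.support := by
  refine (support_coeff_mul_subset p q).antisymm fun x hx ↦ ?_
  obtain ⟨a, ha, b, hb, rfl⟩ := Finset.mem_add.1 hx
  rw [Finsupp.mem_support_iff] at *
  exact hred.coeff_mul_ne_zero ha hb

/-- A coefficient of a product that arises in two different ways is not an additive atom. -/
theorem AddReduced.not_isAddAtom_coeff_mul [NoZeroDivisors S] (hred : AddReduced S)
    {p q : AddMonoidAlgebra S G} {a b c d : G} (hac : a ≠ c) (h : a + b = c + d)
    (ha : p.coeff a ≠ 0) (hb : q.coeff b ≠ 0) (hc : p.coeff c ≠ 0) (hd : q.coeff d ≠ 0) :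
    ¬ IsAddAtom ((p * q).coeff (a + b)) := by
  intro hat
  rcases hat.2 _ _ (coeff_mul_add p q a b) with h0 | h0
  · exact mul_ne_zero ha hb h0
  · rw [h] at h0
    refine hred.coeff_mul_ne_zero ?_ hd h0
    simpa [Finsupp.erase_ne hac.symm] using hc

/-- If `f = p * q` with `p` a monomial and some coefficient of `f` is a unit, then `p` is a
unit. -/
theorem IsMonomial.isUnit_of_mul {p q : AddMonoidAlgebra S G} (hp : IsMonomial p) {g : G}
    (hg : IsUnit ((p * q).coeff g)) : IsUnit p := by
  obtain ⟨h, s, rfl⟩ := hp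
  rw [coeff_single_mul_apply] at hg
  obtain ⟨t, ht⟩ := (isUnit_of_mul_isUnit_left hg).exists_right_inv
  exact IsUnit.of_mul_eq_one (single (-h) t) (by simp [single_mul_single, ht, one_def])

theorem Monolithic.irreducible [NoZeroDivisors S] (hred : AddReduced S)
    {f : AddMonoidAlgebra S G} (hf : Monolithic f) (hcard : 2 ≤ f.coeff.support.card)
    {g : G} (hg : IsUnit (f.coeff g)) : Irreducible f := by
  classical
  refine ⟨fun hu ↦ ?_, fun p q hpq ↦ ?_⟩
  · obtain ⟨q, hq⟩ := hu.exists_right_inv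
    have : Nontrivial S := by
      by_contra h
      rw [not_nontrivial_iff_subsingleton] at h
      exact hf.1 (coeff_injective (Subsingleton.elim _ _))
    have hsupp := hred.support_coeff_mul f q
    rw [hq] at hsupp
    have hne : q.coeff.support.Nonempty := by
      rw [Finsupp.support_nonempty_iff, Ne, coeff_eq_zero]
      rintro rfl
      exact zero_ne_one ((mul_zero f).symm.trans hq)
    have hle := Finset.card_le_card_add_right (s := f.coeff.support) hne
    rw [← hsupp, one_def, coeff_single] at hle
    have := Finset.card_le_card (Finsupp.support_single_subset (a := (0 : G)) (b := (1 : S)))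
    rw [Finset.card_singleton] at this
    omega
  · rw [hpq] at hg
    exact (hf.2 p q hpq).imp (·.isUnit_of_mul hg) fun hq ↦ hq.isUnit_of_mul (mul_comm p q ▸ hg)

theorem AddFurstenberg.exists_isUnit_add (hfur : AddFurstenberg S)
    (hatoms : ∀ a : S, IsAddAtom a ↔ IsUnit a) {s : S} (hs : s ≠ 0) (hsu : ¬ IsUnit s) :
    ∃ u t : S, IsUnit u ∧ u ≠ 0 ∧ t ≠ 0 ∧ s = u + t := by
  obtain ⟨u, t, hu, rfl⟩ := hfur s hs
  refine ⟨u, t, (hatoms u).1 hu, hu.1, ?_, rfl⟩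
  rintro rfl
  exact hsu (by simpa using (hatoms u).1 hu)

theorem add_self_ne_of_add_self_eq [IsAddTorsionFree G] {a b c : G} (hab : a ≠ b) (h : a + a = b + c) :
    b + b ≠ a + c := by
  intro h'
  refine hab (nsmul_right_injective (n := 3) (by norm_num) ?_)
  have hc : c = a + a - b := eq_sub_of_add_eq' h.symm
  rw [hc] at h'
  have : b + b + b = a + a + a := by
    rw [h']; abel
  simpa [succ_nsmul] using this.symm

variable [IsAddTorsionFree G] [NoZeroDivisors S]

theorem AddReduced.card_support_add_le (hred : AddReduced S) {p q : AddMonoidAlgebra S G}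
    (hp : p ≠ 0) (hq : q ≠ 0) :
    p.coeff.support.card + q.coeff.support.card ≤ (p * q).coeff.support.card + 1 := by
  classical
  have := cauchy_davenport_of_isAddTorsionFree
    (Finsupp.support_nonempty_iff.2 (coeff_eq_zero.not.2 hp))
    (Finsupp.support_nonempty_iff.2 (coeff_eq_zero.not.2 hq))
  rw [hred.support_coeff_mul]
  omega

theorem AddReduced.monolithic_of_card_support_eq_two (hred : AddReduced S)
    {f : AddMonoidAlgebra S G} (hf : f.coeff.support.card = 2) : Monolithic f := by
  have hf0 : f ≠ 0 := by rintro rfl; simp at hf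
  refine ⟨hf0, ?_⟩
  rintro p q rfl
  have := hred.card_support_add_le (left_ne_zero_of_mul hf0) (right_ne_zero_of_mul hf0)
  by_contra! h
  have hp := mt isMonomial_of_card_support_le_one h.1
  have hq := mt isMonomial_of_card_support_le_one h.2
  omega

theorem AddReduced.monolithic_of_support_eq_triple [DecidableEq G] (hred : AddReduced S)
    {f : AddMonoidAlgebra S G} {x y z : G} (hxy : x ≠ y) (hyz : y ≠ z) (hxz : x ≠ z)
    (hf : f.coeff.support = {x, y, z}) (hy : IsAddAtom (f.coeff y))
    (hx : x + x ≠ y + z) (hz : z + z ≠ x + y) : Monolithic f := by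
  have hf3 : f.coeff.support.card = 3 := by
    rw [hf, Finset.card_eq_three.2 ⟨x, y, z, hxy, hxz, hyz, rfl⟩]
  have hf0 : f ≠ 0 := by rintro rfl; simp at hf3
  refine ⟨hf0, ?_⟩
  rintro p q rfl
  have hle := hred.card_support_add_le (left_ne_zero_of_mul hf0) (right_ne_zero_of_mul hf0)
  by_contra! h
  have hp := mt isMonomial_of_card_support_le_one h.1
  have hq := mt isMonomial_of_card_support_le_one h.2
  obtain ⟨a, b, hab, hP⟩ := Finset.card_eq_two.1
    (show p.coeff.support.card = 2 by omega)
  obtain ⟨c, d, hcd, hQ⟩ := Finset.card_eq_two.1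
    (show q.coeff.support.card = 2 by omega)
  have hsum := hred.support_coeff_mul p q
  rw [hf, hP, hQ] at hsum
  have ha : p.coeff a ≠ 0 := by rw [← Finsupp.mem_support_iff, hP]; simp
  have hb : p.coeff b ≠ 0 := by rw [← Finsupp.mem_support_iff, hP]; simp
  have hc : q.coeff c ≠ 0 := by rw [← Finsupp.mem_support_iff, hQ]; simp
  have hd : q.coeff d ≠ 0 := by rw [← Finsupp.mem_support_iff, hQ]; simp
  have key : ∀ {c d : G}, c ≠ d → q.coeff c ≠ 0 → q.coeff d ≠ 0 →
      (∀ g, g ∈ ({x, y, z} : Finset G) ↔ g = a + c ∨ g = a + d ∨ g = b + c ∨ g = b + d) →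
      a + d ≠ b + c := by
    intro c d hcd hc hd hmem hadbc
    have hne : a + d ≠ y := by
      intro h
      rw [← h] at hy
      exact hred.not_isAddAtom_coeff_mul hab hadbc ha hd hb hc hy
    have h1 : a + c ≠ a + d := by simpa using hcd
    have h2 : b + d ≠ a + d := by simpa using hab.symm
    have h3 : (a + d) + (a + d) = (a + c) + (b + d) := by
      nth_rw 2 [hadbc]; abel
    generalize a + c = u at *
    generalize b + d = v at *
    generalize b + c = w at *
    generalize a + d = m at *
    have hX := (hmem x).1 (by simp)
    have hY := (hmem y).1 (by simp)
    have hZ := (hmem z).1 (by simp)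
    have := add_comm u v
    have := add_comm x y
    have := add_comm y z
    grind
  have hmem : ∀ g, g ∈ ({x, y, z} : Finset G) ↔
      g = a + c ∨ g = a + d ∨ g = b + c ∨ g = b + d := by
    intro g
    rw [hsum]
    simp [Finset.mem_add]
    grind
  have h1 := key hcd hc hd hmem
  have h2 := key hcd.symm hd hc (fun g ↦ by rw [hmem]; tauto)
  have hA := (hmem (a + c)).2 (by simp)
  have hB := (hmem (a + d)).2 (by simp)
  have hC := (hmem (b + c)).2 (by simp)
  have hD := (hmem (b + d)).2 (by simp)
  have e1 : a + c ≠ a + d := by simpa using hcd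
  have e2 : b + c ≠ b + d := by simpa using hcd
  have e3 : a + c ≠ b + c := by simpa using hab
  have e4 : a + d ≠ b + d := by simpa using hab
  simp only [Finset.mem_insert, Finset.mem_singleton] at hA hB hC hD
  grind

theorem AddReduced.irreducible_binomial (hred : AddReduced S) {g h : G} {s t : S} (hgh : g ≠ h)
    (hs : IsUnit s) (hs0 : s ≠ 0) (ht : t ≠ 0) :
    Irreducible (single g s + single h t : AddMonoidAlgebra S G) := by
  classical
  have hcard : (single g s + single h t : AddMonoidAlgebra S G).coeff.support.card = 2 := by
    refine Finset.card_eq_two.2 ⟨g, h, hgh, ?_⟩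
    ext k
    by_cases h1 : k = g
    · subst h1; simp [hgh, hs0]
    by_cases h2 : k = h
    · subst h2; simp [hgh.symm, ht]
    simp [h1, h2]
  refine (hred.monolithic_of_card_support_eq_two hcard).irreducible hred hcard.ge (g := g) ?_
  simpa [hgh] using hs

theorem AddReduced.irreducible_trinomial (hred : AddReduced S)
    {g₀ g₁ g₂ : G} {s₀ s₁ s₂ : S} (h01 : g₀ ≠ g₁) (h12 : g₁ ≠ g₂) (h02 : g₀ ≠ g₂)
    (hs₀ : s₀ ≠ 0) (hs₁ : IsAddAtom s₁) (hs₁' : IsUnit s₁) (hs₂ : s₂ ≠ 0)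
    (h0 : g₀ + g₀ ≠ g₁ + g₂) (h2 : g₂ + g₂ ≠ g₀ + g₁) :
    Irreducible (single g₀ s₀ + single g₁ s₁ + single g₂ s₂ : AddMonoidAlgebra S G) := by
  classical
  set f := (single g₀ s₀ + single g₁ s₁ + single g₂ s₂ : AddMonoidAlgebra S G) with hf
  have hsupp : f.coeff.support = {g₀, g₁, g₂} := by
    ext k
    by_cases k0 : k = g₀
    · subst k0; simp [hf, h01, h02, hs₀]
    by_cases k1 : k = g₁
    · subst k1; simp [hf, h01.symm, h12, hs₁.1]
    by_cases k2 : k = g₂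
    · subst k2; simp [hf, h02.symm, h12.symm, hs₂]
    simp [hf, k0, k1, k2]
  have hg₁ : f.coeff g₁ = s₁ := by simp [hf, h01, h12.symm]
  refine (hred.monolithic_of_support_eq_triple h01 h12 h02 hsupp (hg₁ ▸ hs₁) h0 h2).irreducible
    hred ?_ (g := g₁) (hg₁ ▸ hs₁')
  rw [hsupp, Finset.card_eq_three.2 ⟨g₀, g₁, g₂, h01, h02, h12, rfl⟩]
  norm_num

/-- A trinomial with both a unit and a non-unit coefficient is a sum of two irreducible
binomials. -/
theorem AddReduced.exists_irreducible_add_of_isUnit (hred : AddReduced S)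
    (hfur : AddFurstenberg S) (hatoms : ∀ a : S, IsAddAtom a ↔ IsUnit a)
    {g₀ g₁ g₂ : G} {s₀ s₁ s₂ : S} (h01 : g₀ ≠ g₁) (h12 : g₁ ≠ g₂)
    (hs₀ : s₀ ≠ 0) (hs₁ : s₁ ≠ 0) (hs₂ : s₂ ≠ 0) (hu₀ : IsUnit s₀) (hu₁ : ¬ IsUnit s₁)
    {f : AddMonoidAlgebra S G} (hf : f = single g₀ s₀ + single g₁ s₁ + single g₂ s₂) :
    ∃ p q : AddMonoidAlgebra S G, Irreducible p ∧ Irreducible q ∧ f = p + q := by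
  obtain ⟨u, t, hu, hu0, ht, rfl⟩ := hfur.exists_isUnit_add hatoms hs₁ hu₁
  refine ⟨_, _, hred.irreducible_binomial h12 hu hu0 hs₂,
    hred.irreducible_binomial h01 hu₀ hs₀ ht, ?_⟩
  rw [hf, single_add]
  abel

/-- Here `g₁` is the only one of the three exponents that may be the midpoint of the other
two. -/
theorem AddReduced.trinomial_goldbach_of_midpoint (hred : AddReduced S)
    (hfur : AddFurstenberg S) (hatoms : ∀ a : S, IsAddAtom a ↔ IsUnit a)
    {g₀ g₁ g₂ : G} {s₀ s₁ s₂ : S} (h01 : g₀ ≠ g₁) (h12 : g₁ ≠ g₂) (h02 : g₀ ≠ g₂)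
    (hs₀ : s₀ ≠ 0) (hs₁ : s₁ ≠ 0) (hs₂ : s₂ ≠ 0)
    (h0 : g₀ + g₀ ≠ g₁ + g₂) (h2 : g₂ + g₂ ≠ g₀ + g₁)
    {f : AddMonoidAlgebra S G} (hf : f = single g₀ s₀ + single g₁ s₁ + single g₂ s₂) :
    (¬ (IsUnit s₀ ∧ IsUnit s₁ ∧ IsUnit s₂) →
      ∃ p q : AddMonoidAlgebra S G, Irreducible p ∧ Irreducible q ∧ f = p + q) ∧
    ((IsUnit s₀ ∧ IsUnit s₁ ∧ IsUnit s₂) → Irreducible f) := by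
  refine ⟨fun hnot ↦ ?_, fun ⟨_, hu, _⟩ ↦ hf ▸ hred.irreducible_trinomial h01 h12 h02 hs₀
    ((hatoms s₁).2 hu) hu hs₂ h0 h2⟩
  have split {g₀ g₁ g₂ : G} {s₀ s₁ s₂ : S} (h01 : g₀ ≠ g₁) (h12 : g₁ ≠ g₂) (hs₀ : s₀ ≠ 0)
      (hs₁ : s₁ ≠ 0) (hs₂ : s₂ ≠ 0) (hu₀ : IsUnit s₀) (hu₁ : ¬ IsUnit s₁)
      (hf : f = single g₀ s₀ + single g₁ s₁ + single g₂ s₂) :=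
    hred.exists_irreducible_add_of_isUnit hfur hatoms h01 h12 hs₀ hs₁ hs₂ hu₀ hu₁ hf
  by_cases u₀ : IsUnit s₀
  · by_cases u₁ : IsUnit s₁
    · exact split h02 h12.symm hs₀ hs₂ hs₁ u₀ (by tauto) (by rw [hf]; abel)
    · exact split h01 h12 hs₀ hs₁ hs₂ u₀ u₁ hf
  by_cases u₁ : IsUnit s₁
  · exact split h01.symm h02 hs₁ hs₀ hs₂ u₁ u₀ (by rw [hf]; abel)
  by_cases u₂ : IsUnit s₂
  · exact split h02.symm h01 hs₂ hs₀ hs₁ u₂ u₀ (by rw [hf]; abel)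
  obtain ⟨u, t, hu, hu0, ht, rfl⟩ := hfur.exists_isUnit_add hatoms hs₀ u₀
  obtain ⟨v, w, hv, hv0, hw, rfl⟩ := hfur.exists_isUnit_add hatoms hs₁ u₁
  refine ⟨_, _, hred.irreducible_binomial h01 hu hu0 hw,
    hred.irreducible_trinomial h01 h12 h02 ht ((hatoms v).2 hv) hv hs₂ h0 h2, ?_⟩
  rw [hf, single_add, single_add]
  abel

end GroupSemidomain

/-- A trinomial in `S[G]` (distinct exponents, nonzero coefficients) that is not a sum of
three unit monomials is a sum of exactly two irreducibles; if all three coefficients are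
units then the trinomial itself is irreducible. -/
theorem trinomial_goldbach
    {S : Type*} [CommSemiring S] {G : Type*} [AddCommGroup G]
    (hS : IsSemidomain S) (hred : AddReduced S) (hfur : AddFurstenberg S)
    (hatoms : ∀ a : S, IsAddAtom a ↔ IsUnit a)
    (htf : ∀ (g : G) (n : ℕ), n ≠ 0 → n • g = 0 → g = 0)
    (s₀ s₁ s₂ : S) (g₀ g₁ g₂ : G)
    (hs₀ : s₀ ≠ 0) (hs₁ : s₁ ≠ 0) (hs₂ : s₂ ≠ 0)
    (h01 : g₀ ≠ g₁) (h12 : g₁ ≠ g₂) (h02 : g₀ ≠ g₂)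
    (f : AddMonoidAlgebra S G)
    (hf : f = AddMonoidAlgebra.single g₀ s₀ + AddMonoidAlgebra.single g₁ s₁ +
        AddMonoidAlgebra.single g₂ s₂) :
    (¬ (IsUnit s₀ ∧ IsUnit s₁ ∧ IsUnit s₂) →
      ∃ p q : AddMonoidAlgebra S G, Irreducible p ∧ Irreducible q ∧ f = p + q) ∧
    ((IsUnit s₀ ∧ IsUnit s₁ ∧ IsUnit s₂) → Irreducible f) := by
  have := hS.noZeroDivisors
  have : IsAddTorsionFree G := ⟨fun n hn a b hab ↦ sub_eq_zero.1
    (htf (a - b) n hn (by rw [nsmul_sub]; exact sub_eq_zero.2 hab))⟩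
  by_cases h0 : g₀ + g₀ = g₁ + g₂
  · have h := hred.trinomial_goldbach_of_midpoint hfur hatoms h01.symm h02 h12 hs₁ hs₀ hs₂
      (add_self_ne_of_add_self_eq h01 h0)
      (add_comm g₁ g₀ ▸ add_self_ne_of_add_self_eq h02 (add_comm g₁ g₂ ▸ h0))
      (f := f) (by rw [hf]; abel)
    exact ⟨fun hn ↦ h.1 fun ⟨a, b, c⟩ ↦ hn ⟨b, a, c⟩, fun ⟨a, b, c⟩ ↦ h.2 ⟨b, a, c⟩⟩
  by_cases h2 : g₂ + g₂ = g₀ + g₁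
  · have h := hred.trinomial_goldbach_of_midpoint hfur hatoms h02 h12.symm h01 hs₀ hs₂ hs₁
      (add_self_ne_of_add_self_eq h02.symm h2)
      (add_comm g₂ g₀ ▸ add_self_ne_of_add_self_eq h12.symm (add_comm g₀ g₁ ▸ h2))
      (f := f) (by rw [hf]; abel)
    exact ⟨fun hn ↦ h.1 fun ⟨a, b, c⟩ ↦ hn ⟨a, c, b⟩, fun ⟨a, b, c⟩ ↦ h.2 ⟨a, c, b⟩⟩
  exact hred.trinomial_goldbach_of_midpoint hfur hatoms h01 h12 h02 hs₀ hs₁ hs₂ h0 h2 hf
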